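/- arXiv:2211.04357 — 2 statements merged into one kernel-verified Lean document; each statement's English description precedes it below -/
import Mathlib

section
/- Let n ≥ 4 and let T be a twin-free tree on n vertices. Then imax(T) ≥ f(n), where f(n) = 4·3^{n/5−1} if n ≡ 0 (mod 5), 5·3^{(n−6)/5} if n ≡ 1, 2·3^{(n−2)/5} if n ≡ 2, 8·3^{(n−8)/5} if n ≡ 3, and 3^{(n+1)/5} if n ≡ 4 (mod 5). -/
open SimpleGraph

/-- `s` is an independent set in `G`. -/
def IsIndep {V : Type*} (G : SimpleGraph V) (s : Set V) : Prop :=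
  ∀ ⦃u⦄, u ∈ s → ∀ ⦃v⦄, v ∈ s → ¬ G.Adj u v

/-- `s` is a maximal independent set in `G`. -/
def IsMaxIndep {V : Type*} (G : SimpleGraph V) (s : Set V) : Prop :=
  IsIndep G s ∧ ∀ t : Set V, IsIndep G t → s ⊆ t → s = t

/-- The number of maximal independent sets of `G`. -/
noncomputable def imax {V : Type*} (G : SimpleGraph V) : ℕ :=
  Set.ncard {s : Set V | IsMaxIndep G s}

/-- `G` is twin-free: no two distinct vertices have the same open neighbourhood. -/
def TwinFree {V : Type*} (G : SimpleGraph V) : Prop :=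
  ∀ u v : V, G.neighborSet u = G.neighborSet v → u = v

/-- The extremal function for the minimum number of maximal independent sets of
twin-free trees: `f 1 = 1`, `f 2 = f 3 = 2`, and for `n ≥ 4` the value depends on
the residue of `n` modulo `5`. -/
noncomputable def f (n : ℕ) : ℝ :=
  if n ≤ 1 then (n : ℝ)
  else if n ≤ 3 then 2
  else if n % 5 = 0 then 4 * (3 : ℝ) ^ ((n : ℝ) / 5 - 1)
  else if n % 5 = 1 then 5 * (3 : ℝ) ^ (((n : ℝ) - 6) / 5)
  else if n % 5 = 2 then 2 * (3 : ℝ) ^ (((n : ℝ) - 2) / 5)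
  else if n % 5 = 3 then 8 * (3 : ℝ) ^ (((n : ℝ) - 8) / 5)
  else (3 : ℝ) ^ (((n : ℝ) + 1) / 5)

namespace TwinFreeTree

/-! ### Numeric part: a finite list of lower-bound vectors closed under joining -/

/-- A scaled lower-bound vector: size modulo 5, the three counts, and the leaf flag. -/
structure Vec where
  r : ℕ
  a : ℕ
  b : ℕ
  c : ℕ
  fl : Bool

/-- The list of lower-bound vectors (all entries scaled by 27). -/
def vecs : List Vec := [
  ⟨0, 0, 36, 0, true⟩, ⟨0, 0, 48, 0, false⟩, ⟨0, 8, 32, 0, true⟩, ⟨0, 9, 27, 9, false⟩,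
  ⟨0, 9, 30, 0, true⟩, ⟨0, 12, 24, 0, true⟩, ⟨0, 15, 15, 15, false⟩, ⟨0, 18, 9, 18, false⟩,
  ⟨0, 18, 18, 0, true⟩, ⟨0, 24, 12, 12, false⟩, ⟨1, 0, 48, 0, true⟩, ⟨1, 0, 60, 0, false⟩,
  ⟨1, 9, 36, 0, true⟩, ⟨1, 12, 36, 12, false⟩, ⟨1, 15, 30, 0, true⟩, ⟨1, 18, 18, 18, false⟩,
  ⟨1, 18, 27, 0, true⟩, ⟨1, 24, 24, 0, true⟩, ⟨1, 27, 18, 9, false⟩, ⟨2, 0, 60, 0, true⟩,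
  ⟨2, 0, 72, 0, false⟩, ⟨2, 12, 48, 0, true⟩, ⟨2, 15, 45, 15, false⟩, ⟨2, 18, 36, 0, true⟩,
  ⟨2, 18, 36, 18, false⟩, ⟨2, 24, 24, 24, false⟩, ⟨2, 27, 18, 27, false⟩, ⟨2, 27, 27, 0, true⟩,
  ⟨2, 36, 18, 18, false⟩, ⟨3, 0, 72, 0, true⟩, ⟨3, 0, 96, 0, false⟩, ⟨3, 15, 60, 0, true⟩,
  ⟨3, 18, 54, 0, true⟩, ⟨3, 18, 54, 18, false⟩, ⟨3, 24, 48, 0, true⟩, ⟨3, 27, 27, 27, false⟩,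
  ⟨3, 27, 45, 0, true⟩, ⟨3, 36, 36, 0, true⟩, ⟨3, 45, 27, 18, false⟩, ⟨4, 0, 96, 0, true⟩,
  ⟨4, 0, 108, 0, false⟩, ⟨4, 18, 72, 0, true⟩, ⟨4, 24, 72, 24, false⟩, ⟨4, 27, 54, 0, true⟩,
  ⟨4, 27, 63, 27, false⟩, ⟨4, 36, 36, 36, false⟩, ⟨4, 45, 45, 0, true⟩, ⟨4, 54, 27, 27, false⟩]

/-- The single-vertex vector. -/
def one : Vec := ⟨1, 27, 0, 27, false⟩

/-- `k` bounds the join of `g` (the root side) with `h` from below. -/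
def below (k g h : Vec) : Bool :=
  k.r == (g.r + h.r) % 5 &&
  Nat.ble (k.a * 27 * 3 ^ ((g.r + h.r) / 5)) (g.a * (h.b + h.c)) &&
  Nat.ble ((k.a + k.b) * 27 * 3 ^ ((g.r + h.r) / 5))
    (g.a * (h.b + h.c) + g.b * (h.a + h.b) + g.c * h.a) &&
  Nat.ble ((k.b + k.c) * 27 * 3 ^ ((g.r + h.r) / 5)) ((g.b + g.c) * (h.a + h.b))

/-- Three times the scaled extremal value. -/
def target : ℕ → ℕ
  | 0 => 4
  | 1 => 5
  | 2 => 6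
  | 3 => 8
  | _ => 9

lemma table_join : ((one :: vecs).all fun g => vecs.all fun h =>
    vecs.any fun k => below k g h && (!k.fl || g.fl)) = true := by
  decide +kernel

lemma table_leaf : ((one :: vecs).all fun g => g.fl ||
    vecs.any fun k => below k g one) = true := by
  decide +kernel

lemma table_final : (vecs.all fun g => vecs.all fun h =>
    Nat.ble (target ((g.r + h.r) % 5) * (27 * 27) * 3 ^ ((g.r + h.r) / 5))
      (3 * (g.a * (h.b + h.c) + g.b * (h.a + h.b) + g.c * h.a))) = true := by
  decide +kernel

/-- The vector `(a,b,c)` at size `n` is bounded below by `g`. -/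
def Bd (g : Vec) (n a b c : ℕ) : Prop :=
  g.r = n % 5 ∧ g.a * 3 ^ (n / 5) ≤ 27 * a ∧ (g.a + g.b) * 3 ^ (n / 5) ≤ 27 * (a + b) ∧
    (g.b + g.c) * 3 ^ (n / 5) ≤ 27 * (b + c)

lemma div_split (m n : ℕ) : (m + n) / 5 = (m % 5 + n % 5) / 5 + (m / 5 + n / 5) := by omega

lemma Bd.mid {g h : Vec} {m n a b c a' b' c' : ℕ} (hg : Bd g m a b c) (hh : Bd h n a' b' c') :
    (g.a * (h.b + h.c) + g.b * (h.a + h.b) + g.c * h.a) * (3 ^ (m / 5) * 3 ^ (n / 5)) ≤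
      27 * 27 * (a * (b' + c') + (b * (a' + b') + c * a')) := by
  obtain ⟨-, h1, h2, h3⟩ := hg
  obtain ⟨-, k1, k2, k3⟩ := hh
  generalize 3 ^ (m / 5) = E at *
  generalize 3 ^ (n / 5) = F at *
  calc (g.a * (h.b + h.c) + g.b * (h.a + h.b) + g.c * h.a) * (E * F)
      = E * (g.a * ((h.b + h.c) * F) + g.b * ((h.a + h.b) * F) + g.c * (h.a * F)) := by ring
    _ ≤ E * (g.a * (27 * (b' + c')) + g.b * (27 * (a' + b')) + g.c * (27 * a')) := by gcongr
    _ = 27 * ((g.a * E) * c' + ((g.a + g.b) * E) * b' + ((g.b + g.c) * E) * a') := by ring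
    _ ≤ 27 * ((27 * a) * c' + (27 * (a + b)) * b' + (27 * (b + c)) * a') := by gcongr
    _ = _ := by ring

lemma Bd.join {k g h : Vec} {m n a b c a' b' c' : ℕ} (hg : Bd g m a b c) (hh : Bd h n a' b' c')
    (hk : below k g h = true) :
    Bd k (m + n) (a * (b' + c')) (b * (a' + b') + c * a') (c * b') := by
  have hmid := hg.mid hh
  obtain ⟨h0, h1, h2, h3⟩ := hg
  obtain ⟨k0, k1, k2, k3⟩ := hh
  simp only [below, Bool.and_eq_true, beq_iff_eq, Nat.ble_eq] at hk
  obtain ⟨⟨⟨e0, e1⟩, e2⟩, e3⟩ := hk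
  rw [h0, k0] at e0 e1 e2 e3
  unfold Bd
  rw [div_split, pow_add, pow_add]
  generalize 3 ^ (m / 5) = E at *
  generalize 3 ^ (n / 5) = F at *
  generalize 3 ^ ((m % 5 + n % 5) / 5) = K at *
  refine ⟨by omega, ?_, ?_, ?_⟩
  · refine Nat.le_of_mul_le_mul_left ?_ (show 0 < 27 by norm_num)
    calc 27 * (k.a * (K * (E * F))) = (k.a * 27 * K) * (E * F) := by ring
      _ ≤ (g.a * (h.b + h.c)) * (E * F) := by gcongr
      _ = (g.a * E) * ((h.b + h.c) * F) := by ring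
      _ ≤ (27 * a) * (27 * (b' + c')) := by gcongr
      _ = _ := by ring
  · refine Nat.le_of_mul_le_mul_left ?_ (show 0 < 27 by norm_num)
    calc 27 * ((k.a + k.b) * (K * (E * F))) = ((k.a + k.b) * 27 * K) * (E * F) := by ring
      _ ≤ _ := Nat.mul_le_mul_right _ e2
      _ ≤ _ := hmid
      _ = _ := by ring
  · refine Nat.le_of_mul_le_mul_left ?_ (show 0 < 27 by norm_num)
    calc 27 * ((k.b + k.c) * (K * (E * F))) = ((k.b + k.c) * 27 * K) * (E * F) := by ring
      _ ≤ ((g.b + g.c) * (h.a + h.b)) * (E * F) := by gcongr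
      _ = ((g.b + g.c) * E) * ((h.a + h.b) * F) := by ring
      _ ≤ (27 * (b + c)) * (27 * (a' + b')) := by gcongr
      _ = _ := by ring

lemma Bd.final {g h : Vec} {m n a b c a' b' c' : ℕ} (hg : Bd g m a b c) (hh : Bd h n a' b' c')
    (h1 : g ∈ vecs) (h2 : h ∈ vecs) :
    target ((m + n) % 5) * 3 ^ ((m + n) / 5) ≤
      3 * (a * (b' + c') + (b * (a' + b') + c * a')) := by
  have hmid := hg.mid hh
  have ht := table_final
  rw [List.all_eq_true] at ht
  have ht := ht g h1
  rw [List.all_eq_true] at ht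
  have ht := ht h h2
  rw [Nat.ble_eq, hg.1, hh.1] at ht
  rw [div_split, pow_add, pow_add, Nat.add_mod]
  generalize 3 ^ (m / 5) = E at *
  generalize 3 ^ (n / 5) = F at *
  generalize 3 ^ ((m % 5 + n % 5) / 5) = K at *
  generalize target _ = t at *
  refine Nat.le_of_mul_le_mul_left ?_ (show 0 < 27 * 27 by norm_num)
  calc 27 * 27 * (t * (K * (E * F))) = (t * (27 * 27) * K) * (E * F) := by ring
    _ ≤ _ := Nat.mul_le_mul_right _ ht
    _ = 3 * ((g.a * (h.b + h.c) + g.b * (h.a + h.b) + g.c * h.a) * (E * F)) := by ring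
    _ ≤ _ := Nat.mul_le_mul_left _ hmid
    _ = _ := by ring

lemma f_eq (n : ℕ) (hn : 4 ≤ n) : f n = (target (n % 5) * 3 ^ (n / 5) : ℕ) / 3 := by
  have h1 : ¬ n ≤ 1 := by omega
  have h3 : ¬ n ≤ 3 := by omega
  have hq : n = 5 * (n / 5) + n % 5 := by omega
  have hr : n % 5 < 5 := Nat.mod_lt _ (by norm_num)
  generalize n / 5 = q at *
  generalize hrr : n % 5 = r at *
  have hqr : (n : ℝ) = 5 * q + r := by rw [hq]; push_cast; ring
  have key : ∀ x : ℝ, x = q - 1 → (3 : ℝ) ^ x = 3 ^ q / 3 := by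
    intro x hx
    rw [hx, Real.rpow_sub_one (by norm_num), Real.rpow_natCast]
  have key' : ∀ x : ℝ, x = q → (3 : ℝ) ^ x = 3 ^ q := by
    intro x hx
    rw [hx, Real.rpow_natCast]
  have key2 : ∀ x : ℝ, x = q + 1 → (3 : ℝ) ^ x = 3 ^ q * 3 := by
    intro x hx
    rw [hx, Real.rpow_add_one (by norm_num), Real.rpow_natCast]
  unfold f
  rw [if_neg h1, if_neg h3, hrr]
  interval_cases r
  · rw [if_pos rfl, key _ (by rw [hqr]; push_cast; ring)]; simp [target]; ring
  · rw [if_neg (by norm_num), if_pos rfl, key _ (by rw [hqr]; push_cast; ring)]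
    simp [target]; ring
  · rw [if_neg (by norm_num), if_neg (by norm_num), if_pos rfl,
      key' _ (by rw [hqr]; push_cast; ring)]
    simp [target]; ring
  · rw [if_neg (by norm_num), if_neg (by norm_num), if_neg (by norm_num), if_pos rfl,
      key _ (by rw [hqr]; push_cast; ring)]
    simp [target]; ring
  · rw [if_neg (by norm_num), if_neg (by norm_num), if_neg (by norm_num), if_neg (by norm_num),
      key2 _ (by rw [hqr]; push_cast; ring)]
    simp [target]; ring

/-! ### Counting part -/

variable {V : Type*}

/-- Independent subsets of `A` dominating all of `A` except possibly `r`. -/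
def Semi (G : SimpleGraph V) (A : Set V) (r : V) (s : Set V) : Prop :=
  s ⊆ A ∧ IsIndep G s ∧ ∀ v ∈ A, v ≠ r → v ∉ s → ∃ u ∈ s, G.Adj v u

/-- Root in the set. -/
def SA (G : SimpleGraph V) (A : Set V) (r : V) : Set (Set V) :=
  {s | Semi G A r s ∧ r ∈ s}

/-- Root outside the set and dominated. -/
def SB (G : SimpleGraph V) (A : Set V) (r : V) : Set (Set V) :=
  {s | Semi G A r s ∧ r ∉ s ∧ ∃ u ∈ s, G.Adj r u}

/-- Root outside the set and not dominated. -/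
def SC (G : SimpleGraph V) (A : Set V) (r : V) : Set (Set V) :=
  {s | Semi G A r s ∧ r ∉ s ∧ ¬ ∃ u ∈ s, G.Adj r u}

lemma mem_SA {G : SimpleGraph V} {A : Set V} {r : V} {s : Set V} :
    s ∈ SA G A r ↔ Semi G A r s ∧ r ∈ s := Iff.rfl

lemma mem_SB {G : SimpleGraph V} {A : Set V} {r : V} {s : Set V} :
    s ∈ SB G A r ↔ Semi G A r s ∧ r ∉ s ∧ ∃ u ∈ s, G.Adj r u := Iff.rfl

lemma mem_SC {G : SimpleGraph V} {A : Set V} {r : V} {s : Set V} :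
    s ∈ SC G A r ↔ Semi G A r s ∧ r ∉ s ∧ ¬ ∃ u ∈ s, G.Adj r u := Iff.rfl

lemma ncard_split {A B : Set V} (hAB : Disjoint A B) (Z : Set (Set V))
    (W : Set (Set V × Set V)) (hZ : ∀ z ∈ Z, z ⊆ A ∪ B) (hW : ∀ p ∈ W, p.1 ⊆ A ∧ p.2 ⊆ B)
    (h : ∀ s t, s ⊆ A → t ⊆ B → (s ∪ t ∈ Z ↔ (s, t) ∈ W)) : Z.ncard = W.ncard := by
  have hr : ∀ p ∈ W, (p.1 ∪ p.2) ∩ A = p.1 ∧ (p.1 ∪ p.2) ∩ B = p.2 := by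
    intro p hp
    obtain ⟨h1, h2⟩ := hW p hp
    constructor
    · rw [Set.union_inter_distrib_right, Set.inter_eq_left.2 h1,
        (hAB.symm.mono_left h2).inter_eq, Set.union_empty]
    · rw [Set.union_inter_distrib_right, Set.inter_eq_left.2 h2,
        (hAB.mono_left h1).inter_eq, Set.empty_union]
  have himg : Z = Set.image (fun p : Set V × Set V => p.1 ∪ p.2) W := by
    ext z
    constructor
    · intro hz
      have hu : z ∩ A ∪ z ∩ B = z := by
        rw [← Set.inter_union_distrib_left]; exact Set.inter_eq_left.2 (hZ z hz)
      exact ⟨(z ∩ A, z ∩ B), (h _ _ Set.inter_subset_right Set.inter_subset_right).1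
        (by rw [hu]; exact hz), hu⟩
    · rintro ⟨p, hp, rfl⟩
      exact (h _ _ (hW p hp).1 (hW p hp).2).2 hp
  rw [himg]
  apply Set.InjOn.ncard_image
  intro p hp q hq hpq
  have hpq : p.1 ∪ p.2 = q.1 ∪ q.2 := hpq
  have e1 := hr p hp
  have e2 := hr q hq
  rw [hpq] at e1
  exact Prod.ext (e1.1.symm.trans e2.1) (e1.2.symm.trans e2.2)

/-- `A` with root `r` and `B` with root `c` are joined by the single edge `rc`. -/
structure Joined (G : SimpleGraph V) (A B : Set V) (r c : V) : Prop where
  disj : Disjoint A B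
  hr : r ∈ A
  hc : c ∈ B
  adj : G.Adj r c
  cross : ∀ x ∈ A, ∀ y ∈ B, G.Adj x y → x = r ∧ y = c

variable {G : SimpleGraph V} {A B : Set V} {r c : V}

lemma Joined.semi (J : Joined G A B r c) {s t : Set V} (hs : s ⊆ A) (ht : t ⊆ B) :
    Semi G (A ∪ B) r (s ∪ t) ↔ Semi G A r s ∧ Semi G B c t ∧ ¬ (r ∈ s ∧ c ∈ t) ∧
      (c ∉ t → r ∉ s → ∃ u ∈ t, G.Adj c u) := by
  have hd : ∀ x ∈ A, x ∉ B := fun x h1 h2 => Set.disjoint_left.1 J.disj h1 h2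
  have hx := J.cross
  have hr := J.hr
  have hc := J.hc
  have hrc := J.adj
  unfold Semi IsIndep
  constructor
  · rintro ⟨-, hi, hdom⟩
    refine ⟨⟨hs, fun u hu v hv => hi (Or.inl hu) (Or.inl hv), ?_⟩,
      ⟨ht, fun u hu v hv => hi (Or.inr hu) (Or.inr hv), ?_⟩, ?_, ?_⟩
    · intro v hv hvr hvs
      obtain ⟨u, hu | hu, huv⟩ := hdom v (Or.inl hv) hvr
        (by rintro (h | h); exacts [hvs h, hd v hv (ht h)])
      · exact ⟨u, hu, huv⟩
      · exact absurd (hx v hv u (ht hu) huv).1 hvr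
    · intro v hv hvr hvs
      obtain ⟨u, hu | hu, huv⟩ := hdom v (Or.inr hv) (by rintro rfl; exact hd _ hr hv)
        (by rintro (h | h); exacts [hd v (hs h) hv, hvs h])
      · exact absurd (hx u (hs hu) v hv huv.symm).2 hvr
      · exact ⟨u, hu, huv⟩
    · rintro ⟨h1, h2⟩
      exact hi (Or.inl h1) (Or.inr h2) hrc
    · intro h1 h2
      obtain ⟨u, hu | hu, huv⟩ := hdom c (Or.inr hc) (by rintro rfl; exact hd _ hr hc)
        (by rintro (h | h); exacts [hd c (hs h) hc, h1 h])
      · rw [(hx u (hs hu) c hc huv.symm).1] at hu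
        exact absurd hu h2
      · exact ⟨u, hu, huv⟩
  · rintro ⟨⟨-, hi1, hd1⟩, ⟨-, hi2, hd2⟩, hn, hcd⟩
    refine ⟨Set.union_subset_union hs ht, ?_, ?_⟩
    · rintro u (hu | hu) v (hv | hv) huv
      · exact hi1 hu hv huv
      · obtain ⟨rfl, rfl⟩ := hx u (hs hu) v (ht hv) huv
        exact hn ⟨hu, hv⟩
      · obtain ⟨rfl, rfl⟩ := hx v (hs hv) u (ht hu) huv.symm
        exact hn ⟨hv, hu⟩
      · exact hi2 hu hv huv
    · rintro v (hv | hv) hvr hvs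
      · obtain ⟨u, hu, h⟩ := hd1 v hv hvr (fun h => hvs (Or.inl h))
        exact ⟨u, Or.inl hu, h⟩
      · have hvt : v ∉ t := fun h => hvs (Or.inr h)
        by_cases hvc : v = c
        · subst hvc
          by_cases hrs : r ∈ s
          · exact ⟨r, Or.inl hrs, hrc.symm⟩
          · obtain ⟨u, hu, h⟩ := hcd hvt hrs
            exact ⟨u, Or.inr hu, h⟩
        · obtain ⟨u, hu, h⟩ := hd2 v hv hvc hvt
          exact ⟨u, Or.inr hu, h⟩

lemma Joined.mem (J : Joined G A B r c) {s t : Set V} (ht : t ⊆ B) :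
    r ∈ s ∪ t ↔ r ∈ s :=
  ⟨fun h => h.elim id fun h => absurd (ht h) (Set.disjoint_left.1 J.disj J.hr), Or.inl⟩

lemma Joined.dom (J : Joined G A B r c) {s t : Set V} (ht : t ⊆ B) :
    (∃ u ∈ s ∪ t, G.Adj r u) ↔ ((∃ u ∈ s, G.Adj r u) ∨ c ∈ t) := by
  constructor
  · rintro ⟨u, hu | hu, h⟩
    · exact Or.inl ⟨u, hu, h⟩
    · rw [(J.cross r J.hr u (ht hu) h).2] at hu
      exact Or.inr hu
  · rintro (⟨u, hu, h⟩ | h)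
    · exact ⟨u, Or.inl hu, h⟩
    · exact ⟨c, Or.inr h, J.adj⟩

lemma disj_AB : Disjoint (SA G A r) (SB G A r) :=
  Set.disjoint_left.2 fun _ h1 h2 => h2.2.1 h1.2

lemma disj_BC : Disjoint (SB G A r) (SC G A r) :=
  Set.disjoint_left.2 fun _ h1 h2 => h2.2.2 h1.2.2

lemma disj_AC : Disjoint (SA G A r) (SC G A r) :=
  Set.disjoint_left.2 fun _ h1 h2 => h2.2.1 h1.2

lemma Joined.card_SA [Finite V] (J : Joined G A B r c) : (SA G (A ∪ B) r).ncard =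
    (SA G A r).ncard * ((SB G B c).ncard + (SC G B c).ncard) := by
  rw [← Set.ncard_union_eq disj_BC, ← Set.ncard_prod]
  refine ncard_split J.disj _ _ (fun z hz => hz.1.1) ?_ ?_
  · rintro ⟨s, t⟩ ⟨h1, h2⟩
    exact ⟨h1.1.1, h2.elim (fun h => h.1.1) (fun h => h.1.1)⟩
  · intro s t hs ht
    rw [Set.mem_prod, Set.mem_union t, mem_SA, mem_SA, mem_SB, mem_SC, J.semi hs ht, J.mem ht]
    dsimp only
    generalize (∃ u ∈ t, G.Adj c u) = X
    generalize Semi G A r s = S₁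
    generalize Semi G B c t = S₂
    generalize (r ∈ s) = rs
    generalize (c ∈ t) = ct
    grind

lemma Joined.card_SC [Finite V] (J : Joined G A B r c) : (SC G (A ∪ B) r).ncard =
    (SC G A r).ncard * (SB G B c).ncard := by
  rw [← Set.ncard_prod]
  refine ncard_split J.disj _ _ (fun z hz => hz.1.1) ?_ ?_
  · rintro ⟨s, t⟩ ⟨h1, h2⟩
    exact ⟨h1.1.1, h2.1.1⟩
  · intro s t hs ht
    rw [Set.mem_prod, mem_SB, mem_SC, mem_SC, J.semi hs ht, J.mem ht, J.dom ht]
    dsimp only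
    generalize (∃ u ∈ t, G.Adj c u) = X
    generalize (∃ u ∈ s, G.Adj r u) = Y
    generalize Semi G A r s = S₁
    generalize Semi G B c t = S₂
    generalize (r ∈ s) = rs
    generalize (c ∈ t) = ct
    grind

lemma Joined.card_SB [Finite V] (J : Joined G A B r c) : (SB G (A ∪ B) r).ncard =
    (SB G A r).ncard * ((SA G B c).ncard + (SB G B c).ncard) +
      (SC G A r).ncard * (SA G B c).ncard := by
  rw [← Set.ncard_union_eq disj_AB, ← Set.ncard_prod, ← Set.ncard_prod, ← Set.ncard_union_eq]
  · refine ncard_split J.disj _ _ (fun z hz => hz.1.1) ?_ ?_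
    · rintro ⟨s, t⟩ (⟨h1, h2⟩ | ⟨h1, h2⟩)
      · exact ⟨h1.1.1, h2.elim (fun h => h.1.1) (fun h => h.1.1)⟩
      · exact ⟨h1.1.1, h2.1.1⟩
    · intro s t hs ht
      rw [Set.mem_union (s, t), Set.mem_prod, Set.mem_prod, Set.mem_union t, mem_SA, mem_SB,
        mem_SB, mem_SB, mem_SC, J.semi hs ht, J.mem ht, J.dom ht]
      dsimp only
      generalize (∃ u ∈ t, G.Adj c u) = X
      generalize (∃ u ∈ s, G.Adj r u) = Y
      generalize Semi G A r s = S₁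
      generalize Semi G B c t = S₂
      generalize (r ∈ s) = rs
      generalize (c ∈ t) = ct
      grind
  · exact Set.disjoint_left.2 fun p h1 h2 => Set.disjoint_left.1 disj_BC h1.1 h2.1

lemma imax_eq [Finite V] (G : SimpleGraph V) (r : V) :
    imax G = (SA G Set.univ r).ncard + (SB G Set.univ r).ncard := by
  rw [← Set.ncard_union_eq disj_AB]
  unfold imax
  congr 1
  ext s
  simp only [SA, SB, Semi, Set.mem_ofPred_eq, Set.mem_union]
  constructor
  · rintro ⟨hi, hm⟩
    have hd : ∀ v, v ∉ s → ∃ u ∈ s, G.Adj v u := by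
      intro v hv
      by_contra hcon
      push Not at hcon
      refine hv ?_
      rw [hm (insert v s) ?_ (Set.subset_insert _ _)]
      · exact Set.mem_insert _ _
      · rintro u (rfl | hu) w (rfl | hw) h
        · exact G.loopless.irrefl _ h
        · exact hcon w hw h
        · exact hcon u hu h.symm
        · exact hi hu hw h
    by_cases hr : r ∈ s
    · exact Or.inl ⟨⟨Set.subset_univ _, hi, fun v _ _ => hd v⟩, hr⟩
    · exact Or.inr ⟨⟨Set.subset_univ _, hi, fun v _ _ => hd v⟩, hr, hd r hr⟩
  · intro h
    have hi : IsIndep G s := h.elim (fun h => h.1.2.1) (fun h => h.1.2.1)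
    have hd : ∀ v, v ∉ s → ∃ u ∈ s, G.Adj v u := by
      intro v hv
      rcases h with h | h
      · exact h.1.2.2 v trivial (by rintro rfl; exact hv h.2) hv
      · by_cases hvr : v = r
        · subst hvr; exact h.2.2
        · exact h.1.2.2 v trivial hvr hv
    refine ⟨hi, fun t ht hst => hst.antisymm fun v hv => ?_⟩
    by_contra hvs
    obtain ⟨u, hu, h⟩ := hd v hvs
    exact ht hv (hst hu) h

lemma bd_one (G : SimpleGraph V) (r : V) :
    Bd one ({r} : Set V).ncard (SA G {r} r).ncard (SB G {r} r).ncard (SC G {r} r).ncard := by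
  have hA : SA G {r} r = {{r}} := by
    ext s
    simp only [SA, Semi, Set.mem_ofPred_eq, Set.mem_singleton_iff]
    constructor
    · rintro ⟨⟨h, -⟩, h2⟩
      exact h.antisymm (by simpa using h2)
    · rintro rfl
      refine ⟨⟨subset_rfl, ?_, fun v h1 h2 => absurd h1 h2⟩, rfl⟩
      rintro u rfl v rfl
      exact G.loopless.irrefl _
  have hB : SB G {r} r = ∅ := by
    ext s
    simp only [SB, Semi, Set.mem_ofPred_eq, Set.mem_empty_iff_false, iff_false]
    rintro ⟨⟨h, -⟩, h2, u, hu, -⟩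
    have := h hu
    rw [Set.mem_singleton_iff] at this
    exact h2 (this ▸ hu)
  have hC : SC G {r} r = {∅} := by
    ext s
    simp only [SC, Semi, Set.mem_ofPred_eq, Set.mem_singleton_iff]
    constructor
    · rintro ⟨⟨h, -⟩, h2, -⟩
      rcases Set.subset_singleton_iff_eq.1 h with h | h
      · exact h
      · rw [h] at h2; exact absurd rfl h2
    · rintro rfl
      refine ⟨⟨Set.empty_subset _, fun u h => absurd h (Set.notMem_empty u),
        fun v h1 h2 => absurd h1 h2⟩, Set.notMem_empty _, ?_⟩
      rintro ⟨u, h, -⟩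
      exact h
  rw [hA, hB, hC]
  simp [Bd, one]

/-! ### Structural part -/

/-- A branch: connected from `r`, with all edges leaving `A` at `r`. -/
structure Branch (G : SimpleGraph V) (A : Set V) (r : V) : Prop where
  hr : r ∈ A
  conn : ∀ v ∈ A, Relation.ReflTransGen (fun x y => y ∈ A ∧ G.Adj x y) r v
  closed : ∀ u ∈ A, u ≠ r → ∀ w, G.Adj u w → w ∈ A

/-- Some leaf of `G` in `A` hangs at `r`. -/
def HasLeaf (G : SimpleGraph V) (A : Set V) (r : V) : Prop :=
  ∃ u ∈ A, u ≠ r ∧ ∀ w, G.Adj u w ↔ w = r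

lemma Branch.split (hG : G.IsAcyclic) (hA : Branch G A r) (hc : c ∈ A) (hrc : G.Adj r c) :
    ∃ A₁ A₂, A₁ ∪ A₂ = A ∧ Joined G A₁ A₂ r c ∧ Branch G A₁ r ∧ Branch G A₂ c := by
  have hb : G.IsBridge s(r, c) := by
    apply SimpleGraph.isAcyclic_iff_forall_adj_isBridge.1 hG hrc
  rw [SimpleGraph.isBridge_iff] at hb
  set G' := G.deleteEdges {s(r, c)} with hG'
  set C : Set V := {v | G'.Reachable c v} with hC
  have hcC : c ∈ C := SimpleGraph.Reachable.refl _
  have hrC : r ∉ C := fun h => hb (SimpleGraph.Reachable.symm h)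
  have hcross : ∀ x y, x ∉ C → y ∈ C → G.Adj x y → x = r ∧ y = c := by
    intro x y hx hy hxy
    by_contra hcon
    have hadj : G'.Adj y x := by
      rw [hG', SimpleGraph.deleteEdges_adj]
      refine ⟨hxy.symm, ?_⟩
      rw [Set.mem_singleton_iff, Sym2.eq_iff]
      rintro (⟨rfl, rfl⟩ | ⟨rfl, rfl⟩)
      · exact hrC hy
      · exact hcon ⟨rfl, rfl⟩
    exact hx (SimpleGraph.Reachable.trans hy hadj.reachable)
  have hconn : ∀ v ∈ A, (v ∉ C → Relation.ReflTransGen (fun x y => y ∈ A \ C ∧ G.Adj x y) r v) ∧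
      (v ∈ C → Relation.ReflTransGen (fun x y => y ∈ A ∩ C ∧ G.Adj x y) c v) := by
    intro v hv
    have h := hA.conn v hv
    clear hv
    induction h with
    | refl => exact ⟨fun _ => .refl, fun h => absurd h hrC⟩
    | @tail x y _ hxy ih =>
      obtain ⟨hy, hadj⟩ := hxy
      constructor
      · intro hyC
        by_cases hxC : x ∈ C
        · rw [(hcross y x hyC hxC hadj.symm).1]
        · exact (ih.1 hxC).tail ⟨⟨hy, hyC⟩, hadj⟩
      · intro hyC
        by_cases hxC : x ∈ C
        · exact (ih.2 hxC).tail ⟨⟨hy, hyC⟩, hadj⟩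
        · rw [(hcross x y hxC hyC hadj).2]
  refine ⟨A \ C, A ∩ C, Set.sdiff_union_inter A C, ⟨?_, ⟨hA.hr, hrC⟩, ⟨hc, hcC⟩, hrc, ?_⟩,
    ⟨⟨hA.hr, hrC⟩, ?_, ?_⟩, ⟨⟨hc, hcC⟩, ?_, ?_⟩⟩
  · exact Set.disjoint_left.2 fun x h1 h2 => h1.2 h2.2
  · intro x hx y hy h
    exact hcross x y hx.2 hy.2 h
  · intro v hv
    exact (hconn v hv.1).1 hv.2
  · intro u hu hur w hw
    exact ⟨hA.closed u hu.1 hur w hw, fun h => hur (hcross u w hu.2 h hw).1⟩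
  · intro v hv
    exact (hconn v hv.1).2 hv.2
  · intro u hu huc w hw
    refine ⟨hA.closed u hu.1 (by rintro rfl; exact hrC hu.2) w hw, ?_⟩
    by_contra h
    exact huc (hcross w u h hu.2 hw.symm).2

/-- The main invariant. -/
lemma main_inv [Finite V] (hG : G.IsAcyclic) (htf : TwinFree G) :
    ∀ (n : ℕ) (A : Set V) (r : V), A.ncard = n → Branch G A r →
      ∃ g ∈ one :: vecs, (A ≠ {r} → g ∈ vecs) ∧ (A = {r} → g = one) ∧
        (g.fl = true → HasLeaf G A r) ∧
        Bd g A.ncard (SA G A r).ncard (SB G A r).ncard (SC G A r).ncard := by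
  intro n
  induction n using Nat.strong_induction_on with
  | _ n ih =>
  intro A r hn hA
  by_cases hsing : A = {r}
  · refine ⟨one, List.mem_cons_self, fun h => absurd hsing h, fun _ => rfl,
      fun h => by simp [one] at h, ?_⟩
    rw [hsing]; exact bd_one G r
  obtain ⟨v, hv, hvr⟩ : ∃ v ∈ A, v ≠ r := by
    by_contra hcon
    push Not at hcon
    exact hsing (Set.eq_singleton_iff_unique_mem.2 ⟨hA.hr, hcon⟩)
  obtain ⟨c, hc, hrc⟩ : ∃ c ∈ A, G.Adj r c := by
    rcases (Relation.ReflTransGen.cases_head (hA.conn v hv)) with h | ⟨c, h, -⟩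
    · exact absurd h.symm hvr
    · exact ⟨c, h.1, h.2⟩
  obtain ⟨A₁, A₂, hU, J, B₁, B₂⟩ := hA.split hG hc hrc
  have hcard : A.ncard = A₁.ncard + A₂.ncard := by rw [← hU, Set.ncard_union_eq J.disj]
  have hp1 : 0 < A₁.ncard := (Set.ncard_pos).2 ⟨r, J.hr⟩
  have hp2 : 0 < A₂.ncard := (Set.ncard_pos).2 ⟨c, J.hc⟩
  obtain ⟨g, hgm, -, hg1, hgl, hgb⟩ := ih A₁.ncard (by omega) A₁ r rfl B₁
  obtain ⟨h, hhm, hhv, hh1, hhl, hhb⟩ := ih A₂.ncard (by omega) A₂ c rfl B₂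
  have hleaf1 : HasLeaf G A₁ r → HasLeaf G A r := by
    rintro ⟨u, hu, h2⟩
    exact ⟨u, hU ▸ Or.inl hu, h2⟩
  have fin : ∀ k : Vec, below k g h = true →
      Bd k A.ncard (SA G A r).ncard (SB G A r).ncard (SC G A r).ncard := by
    intro k hk
    have := hgb.join hhb hk
    rw [← J.card_SA, ← J.card_SB, ← J.card_SC, hU, ← hcard] at this
    exact this
  by_cases hs2 : A₂ = {c}
  · have hcr : c ≠ r := hrc.ne'
    have hcl : ∀ w, G.Adj c w ↔ w = r := by
      intro w
      constructor
      · intro hw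
        have hwA := hA.closed c hc hcr w hw
        rw [← hU] at hwA
        rcases hwA with h' | h'
        · exact (J.cross w h' c J.hc hw.symm).1
        · rw [hs2, Set.mem_singleton_iff] at h'
          subst h'
          exact absurd hw (G.loopless.irrefl _)
      · rintro rfl; exact hrc.symm
    have hnl : ¬ HasLeaf G A₁ r := by
      rintro ⟨u, hu, -, hul⟩
      have : u = c := htf u c (by ext w; simp [hul, hcl])
      subst this
      exact Set.disjoint_left.1 J.disj hu J.hc
    have hgf : g.fl = false := by
      by_contra hcon
      exact hnl (hgl (by simpa using hcon))
    have ht := table_leaf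
    rw [List.all_eq_true] at ht
    have ht := ht g hgm
    rw [hgf, Bool.false_or, List.any_eq_true] at ht
    obtain ⟨k, hkm, hk⟩ := ht
    rw [← hh1 hs2] at hk
    exact ⟨k, List.mem_cons_of_mem _ hkm, fun _ => hkm, fun h => absurd h hsing,
      fun _ => ⟨c, hc, hcr, hcl⟩, fin k hk⟩
  · have ht := table_join
    rw [List.all_eq_true] at ht
    have ht := ht g hgm
    rw [List.all_eq_true] at ht
    have ht := ht h (hhv hs2)
    rw [List.any_eq_true] at ht
    obtain ⟨k, hkm, hk⟩ := ht
    rw [Bool.and_eq_true] at hk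
    refine ⟨k, List.mem_cons_of_mem _ hkm, fun _ => hkm, fun h => absurd h hsing, ?_, fin k hk.1⟩
    intro hkf
    have h2 := hk.2
    rw [hkf] at h2
    exact hleaf1 (hgl (by simpa using h2))

/-- There is an edge whose two ends both have further neighbours. -/
lemma exists_inner_edge [Fintype V] (hconn : G.Connected) (htf : TwinFree G)
    (hn : 4 ≤ Fintype.card V) :
    ∃ r c, G.Adj r c ∧ (∃ x, G.Adj r x ∧ x ≠ c) ∧ ∃ y, G.Adj c y ∧ y ≠ r := by
  by_contra hcon
  push Not at hcon
  have hsub : ∀ r c₁ c₂, G.Adj r c₁ → G.Adj r c₂ → c₁ = c₂ := by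
    intro r c₁ c₂ h1 h2
    by_contra hne
    have e1 := hcon r c₁ h1 ⟨c₂, h2, Ne.symm hne⟩
    have e2 := hcon r c₂ h2 ⟨c₁, h1, hne⟩
    refine hne (htf c₁ c₂ ?_)
    ext w
    simp only [SimpleGraph.mem_neighborSet]
    constructor
    · intro h; rw [e1 w h]; exact h2.symm
    · intro h; rw [e2 w h]; exact h1.symm
  obtain ⟨v⟩ := hconn.nonempty
  have hall : ∀ x, x = v ∨ G.Adj v x := by
    intro x
    have h := (SimpleGraph.reachable_iff_reflTransGen v x).1 (hconn.preconnected v x)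
    induction h with
    | refl => exact Or.inl rfl
    | tail _ h ih =>
      rcases ih with rfl | ih
      · exact Or.inr h
      · exact Or.inl (hsub _ _ _ h ih.symm)
  have h1 : ({v} ∪ {x | G.Adj v x} : Set V) = Set.univ := by
    ext x; simpa using hall x
  have h2 : ({x | G.Adj v x} : Set V).ncard ≤ 1 :=
    (Set.ncard_le_one_iff (Set.toFinite _)).2 fun h h' => hsub _ _ _ h h'
  have h3 := Set.ncard_union_le ({v} : Set V) {x | G.Adj v x}
  rw [h1, Set.ncard_univ, Nat.card_eq_fintype_card, Set.ncard_singleton] at h3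
  omega

lemma main_bound [Fintype V] (hG : G.IsTree) (htf : TwinFree G) (hn : 4 ≤ Fintype.card V) :
    target (Fintype.card V % 5) * 3 ^ (Fintype.card V / 5) ≤ 3 * imax G := by
  obtain ⟨r, c, hrc, ⟨x, hx, hxc⟩, ⟨y, hy, hyr⟩⟩ := exists_inner_edge hG.connected htf hn
  have hB : Branch G Set.univ r := by
    refine ⟨trivial, fun v _ => ?_, fun _ _ _ _ _ => trivial⟩
    have h := (SimpleGraph.reachable_iff_reflTransGen r v).1 (hG.connected.preconnected r v)
    exact Relation.ReflTransGen.mono (fun _ _ h => ⟨trivial, h⟩) _ _ h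
  obtain ⟨A₁, A₂, hU, J, B₁, B₂⟩ := hB.split hG.isAcyclic trivial hrc
  have hcard : Fintype.card V = A₁.ncard + A₂.ncard := by
    rw [← Set.ncard_union_eq J.disj, hU, Set.ncard_univ, Nat.card_eq_fintype_card]
  have hmem : ∀ z, z ∈ A₁ ∨ z ∈ A₂ := fun z => by
    have : z ∈ A₁ ∪ A₂ := hU ▸ trivial
    exact this
  have hs1 : A₁ ≠ {r} := by
    intro h
    rcases hmem x with hm | hm
    · rw [h, Set.mem_singleton_iff] at hm
      subst hm
      exact G.loopless.irrefl _ hx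
    · exact hxc (J.cross r J.hr x hm hx).2
  have hs2 : A₂ ≠ {c} := by
    intro h
    rcases hmem y with hm | hm
    · exact hyr (J.cross y hm c J.hc hy.symm).1
    · rw [h, Set.mem_singleton_iff] at hm
      subst hm
      exact G.loopless.irrefl _ hy
  obtain ⟨g, -, hgv, -, -, hgb⟩ := main_inv hG.isAcyclic htf _ A₁ r rfl B₁
  obtain ⟨h, -, hhv, -, -, hhb⟩ := main_inv hG.isAcyclic htf _ A₂ c rfl B₂
  have := hgb.final hhb (hgv hs1) (hhv hs2)
  rw [← J.card_SA, ← J.card_SB, hU, ← hcard, ← imax_eq] at this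
  exact this

end TwinFreeTree

theorem stmt_14 {V : Type*} [Fintype V] (T : SimpleGraph V)
    (htree : T.IsTree) (htf : TwinFree T) (hn : 4 ≤ Fintype.card V) :
    f (Fintype.card V) ≤ (imax T : ℝ) := by
  have h := TwinFreeTree.main_bound htree htf hn
  rw [TwinFreeTree.f_eq _ hn, div_le_iff₀ (by norm_num)]
  have h' : ((TwinFreeTree.target (Fintype.card V % 5) * 3 ^ (Fintype.card V / 5) : ℕ) : ℝ) ≤
      ((3 * imax T : ℕ) : ℝ) := Nat.cast_le.2 h
  rw [Nat.cast_mul 3] at h'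
  push_cast at h' ⊢
  linarith
end

section
/- Let F be a twin-free forest on n ≥ 2 vertices. Then imax(F) ≥ f(n−1), where f(1)=1, f(2)=f(3)=2, and for m ≥ 4: f(m) = 4·3^{m/5−1} if m ≡ 0 (mod 5), 5·3^{(m−6)/5} if m ≡ 1, 2·3^{(m−2)/5} if m ≡ 2, 8·3^{(m−8)/5} if m ≡ 3, 3^{(m+1)/5} if m ≡ 4. -/
open SimpleGraph

section Helpers

/-- Shifted integer version of the extremal function. -/
def hh : ℕ → ℕ
  | 0 => 1 | 1 => 2 | 2 => 2 | 3 => 2 | 4 => 3 | 5 => 3 | 6 => 4 | 7 => 5 | 8 => 6 | 9 => 8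
  | (n + 10) => 3 * hh (n + 5)

lemma hh_rec (n : ℕ) : hh (n + 10) = 3 * hh (n + 5) := by rw [hh]

lemma hh_mono1 (n : ℕ) : hh n ≤ hh (n + 1) := by
  induction n using Nat.strong_induction_on with
  | _ n ih =>
    by_cases h : n < 10
    · interval_cases n <;> decide
    · obtain ⟨m, rfl⟩ : ∃ m, n = m + 10 := ⟨n - 10, by omega⟩
      have := ih (m + 5) (by omega)
      rw [show m + 10 + 1 = (m + 1) + 10 by ring, hh_rec, hh_rec]
      rw [show m + 1 + 5 = m + 5 + 1 by ring]
      omega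

lemma hh_mono : Monotone hh := monotone_nat_of_le_succ hh_mono1

lemma hh_three (n : ℕ) : hh n ≤ 2 * hh (n - 3) := by
  induction n using Nat.strong_induction_on with
  | _ n ih =>
    by_cases h : n < 13
    · interval_cases n <;> decide
    · obtain ⟨m, rfl⟩ : ∃ m, n = m + 13 := ⟨n - 13, by omega⟩
      have := ih (m + 8) (by omega)
      rw [show m + 8 - 3 = m + 5 by omega] at this
      rw [show m + 13 - 3 = m + 10 by omega, show m + 13 = (m + 3) + 10 by ring, hh_rec, hh_rec]
      rw [show m + 3 + 5 = m + 8 by ring]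
      omega

lemma hh_five (n : ℕ) : hh n ≤ 3 * hh (n - 5) := by
  by_cases h : n < 10
  · interval_cases n <;> decide
  · obtain ⟨m, rfl⟩ : ∃ m, n = m + 10 := ⟨n - 10, by omega⟩
    rw [hh_rec, show m + 10 - 5 = m + 5 by omega]

lemma hh_two_four (n : ℕ) : hh n ≤ hh (n - 2) + hh (n - 4) := by
  induction n using Nat.strong_induction_on with
  | _ n ih =>
    by_cases h : n < 14
    · interval_cases n <;> decide
    · obtain ⟨m, rfl⟩ : ∃ m, n = m + 14 := ⟨n - 14, by omega⟩
      have := ih (m + 9) (by omega)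
      rw [show m + 9 - 2 = m + 7 by omega, show m + 9 - 4 = m + 5 by omega] at this
      rw [show m + 14 - 4 = m + 10 by omega, show m + 14 - 2 = (m + 2) + 10 by omega,
        show m + 14 = (m + 4) + 10 by ring, hh_rec, hh_rec, hh_rec]
      rw [show m + 4 + 5 = m + 9 by ring, show m + 2 + 5 = m + 7 by ring]
      omega

lemma f_rec (n : ℕ) (hn : 4 ≤ n) : f (n + 5) = 3 * f n := by
  have h3 : (0 : ℝ) < 3 := by norm_num
  have key : ∀ x y : ℝ, y = x + 1 → (3 : ℝ) ^ y = 3 * 3 ^ x := by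
    rintro x y rfl
    rw [Real.rpow_add h3, Real.rpow_one]; ring
  have e : (n + 5) % 5 = n % 5 := by omega
  unfold f
  rw [if_neg (by omega), if_neg (by omega), if_neg (by omega : ¬ n ≤ 1),
    if_neg (by omega : ¬ n ≤ 3), e]
  split_ifs
  · rw [key ((n : ℝ) / 5 - 1) _ (by push_cast; ring)]; ring
  · rw [key (((n : ℝ) - 6) / 5) _ (by push_cast; ring)]; ring
  · rw [key (((n : ℝ) - 2) / 5) _ (by push_cast; ring)]; ring
  · rw [key (((n : ℝ) - 8) / 5) _ (by push_cast; ring)]; ring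
  · rw [key (((n : ℝ) + 1) / 5) _ (by push_cast; ring)]

lemma f_le_hh (n : ℕ) : f n ≤ (hh (n + 1) : ℝ) := by
  induction n using Nat.strong_induction_on with
  | _ n ih =>
    by_cases h : n < 9
    · interval_cases n <;> norm_num [f, hh]
    · obtain ⟨m, rfl⟩ : ∃ m, n = m + 9 := ⟨n - 9, by omega⟩
      have := ih (m + 4) (by omega)
      rw [show m + 9 = (m + 4) + 5 by ring, f_rec _ (by omega),
        show m + 4 + 5 + 1 = m + 10 by ring, hh_rec]
      push_cast
      rw [show m + 4 + 1 = m + 5 by ring] at this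
      linarith

open Classical in
/-- neighbours of `v` inside `W` -/
noncomputable def nb {V : Type*} (G : SimpleGraph V) (W : Finset V) (v : V) : Finset V :=
  W.filter (fun a => G.Adj v a)

lemma mem_nb {V : Type*} {G : SimpleGraph V} {W : Finset V} {v a : V} :
    a ∈ nb G W v ↔ a ∈ W ∧ G.Adj v a := by
  classical
  simp [nb]

/-- maximal independent subset of `W` -/
def MI {V : Type*} (G : SimpleGraph V) (W s : Finset V) : Prop :=
  s ⊆ W ∧ (∀ a ∈ s, ∀ b ∈ s, ¬ G.Adj a b) ∧ ∀ a ∈ W, a ∉ s → ∃ b ∈ s, G.Adj a b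

open Classical in
/-- number of maximal independent subsets of `W` -/
noncomputable def cnt {V : Type*} (G : SimpleGraph V) (W : Finset V) : ℕ :=
  (W.powerset.filter (MI G W)).card

open Classical in
lemma exists_ext {V : Type*} (G : SimpleGraph V) (W s : Finset V) (hs : s ⊆ W)
    (hi : ∀ a ∈ s, ∀ b ∈ s, ¬ G.Adj a b) : ∃ M, MI G W M ∧ s ⊆ M := by
  let P := W.powerset.filter (fun t => s ⊆ t ∧ ∀ a ∈ t, ∀ b ∈ t, ¬ G.Adj a b)
  have hP : P.Nonempty := ⟨s, by simp [P, hs]; exact hi⟩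
  obtain ⟨M, hM, hmax⟩ := Finset.exists_max_image P Finset.card hP
  simp only [P, Finset.mem_filter, Finset.mem_powerset] at hM hmax
  refine ⟨M, ⟨hM.1, hM.2.2, ?_⟩, hM.2.1⟩
  intro a ha haM
  by_contra hcon
  push Not at hcon
  have := hmax (insert a M) ⟨Finset.insert_subset ha hM.1,
    hM.2.1.trans (Finset.subset_insert _ _), ?_⟩
  · rw [Finset.card_insert_of_notMem haM] at this
    omega
  · intro x hx y hy
    rw [Finset.mem_insert] at hx hy
    rcases hx with rfl | hx <;> rcases hy with rfl | hy
    · exact G.loopless.irrefl _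
    · exact hcon y hy
    · exact fun h => hcon x hx h.symm
    · exact hM.2.2 x hx y hy

open Classical in
lemma cnt_le_filter {V : Type*} (G : SimpleGraph V) (W W' : Finset V) (hW : W' ⊆ W) (T : Finset V)
    (hT : T ⊆ W) (hTi : ∀ a ∈ T, ∀ b ∈ T, ¬ G.Adj a b) (hTW : ∀ t ∈ T, ∀ a ∈ W', ¬ G.Adj t a) :
    cnt G W' ≤ ((W.powerset.filter (MI G W)).filter (fun M => T ⊆ M)).card := by
  apply Finset.card_le_card_of_surjOn (fun M => M ∩ W')
  intro s hs
  simp only [Finset.coe_filter, Finset.mem_powerset, Set.mem_ofPred_eq] at hs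
  obtain ⟨-, h1, h2, h3⟩ := hs
  obtain ⟨M, hM, hsub⟩ := exists_ext G W (T ∪ s) (Finset.union_subset hT (h1.trans hW)) (by
    intro a ha b hb
    rw [Finset.mem_union] at ha hb
    rcases ha with ha | ha <;> rcases hb with hb | hb
    · exact hTi a ha b hb
    · exact hTW a ha b (h1 hb)
    · exact fun h => hTW b hb a (h1 ha) h.symm
    · exact h2 a ha b hb)
  refine ⟨M, ?_, ?_⟩
  · simp only [Finset.coe_filter, Finset.mem_filter, Finset.mem_powerset, Set.mem_ofPred_eq]
    exact ⟨⟨hM.1, hM⟩, (Finset.subset_union_left).trans hsub⟩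
  · ext a
    simp only [Finset.mem_inter]
    constructor
    · rintro ⟨haM, haW⟩
      by_contra has
      obtain ⟨b, hb, hab⟩ := h3 a haW has
      exact hM.2.1 a haM b (hsub (Finset.mem_union_right _ hb)) hab
    · intro ha
      exact ⟨hsub (Finset.mem_union_right _ ha), h1 ha⟩

lemma cnt_mono {V : Type*} (G : SimpleGraph V) (W W' : Finset V) (hW : W' ⊆ W) :
    cnt G W' ≤ cnt G W := by
  classical
  refine (cnt_le_filter G W W' hW ∅ (by simp) (by simp) (by simp)).trans ?_
  exact Finset.card_le_card (Finset.filter_subset _ _)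

lemma cnt_add {V : Type*} (G : SimpleGraph V) (W W1 W2 : Finset V) (h1 : W1 ⊆ W) (h2 : W2 ⊆ W)
    (l u : V) (hl : l ∈ W) (hu : u ∈ W) (hlu : G.Adj l u)
    (hl1 : ∀ a ∈ W1, ¬ G.Adj l a) (hu2 : ∀ a ∈ W2, ¬ G.Adj u a) :
    cnt G W1 + cnt G W2 ≤ cnt G W := by
  classical
  have e1 := cnt_le_filter G W W1 h1 {l} (by simpa using hl) (by simp) (by simpa using hl1)
  have e2 := cnt_le_filter G W W2 h2 {u} (by simpa using hu) (by simp) (by simpa using hu2)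
  refine (Nat.add_le_add e1 e2).trans ?_
  rw [← Finset.card_union_of_disjoint]
  · apply Finset.card_le_card
    exact Finset.union_subset (Finset.filter_subset _ _) (Finset.filter_subset _ _)
  · rw [Finset.disjoint_left]
    intro M hM hM'
    simp only [Finset.mem_filter, Finset.singleton_subset_iff] at hM hM'
    exact hM.1.2.2.1 l hM.2 u hM'.2 hlu

lemma cnt_empty {V : Type*} (G : SimpleGraph V) : 1 ≤ cnt G ∅ := by
  classical
  unfold cnt
  rw [Nat.one_le_iff_ne_zero, ← Nat.pos_iff_ne_zero, Finset.card_pos]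
  exact ⟨∅, by simp [MI]⟩

lemma cnt_le_imax {V : Type*} [Fintype V] (G : SimpleGraph V) :
    cnt G Finset.univ ≤ imax G := by
  classical
  unfold cnt imax
  rw [← Set.ncard_coe_finset]
  refine Set.ncard_le_ncard_of_injOn (fun s : Finset V => (s : Set V)) ?_ ?_ ?_
  · intro s hs
    simp only [Finset.coe_filter, Finset.mem_powerset, Set.mem_ofPred_eq] at hs
    obtain ⟨-, -, h2, h3⟩ := hs
    refine ⟨fun a ha b hb => h2 a ha b hb, ?_⟩
    intro t ht hst
    refine Set.Subset.antisymm hst ?_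
    intro a ha
    by_contra has
    obtain ⟨b, hb, hab⟩ := h3 a (Finset.mem_univ _) has
    exact ht ha (hst hb) hab
  · intro a _ b _ h
    exact Finset.coe_injective h
  · exact Set.toFinite _

/-- degree sum inside `W` -/
noncomputable def dsum {V : Type*} (G : SimpleGraph V) (W : Finset V) : ℕ :=
  ∑ v ∈ W, (nb G W v).card

lemma dsum_erase {V : Type*} [DecidableEq V] (G : SimpleGraph V) (W : Finset V) (v : V)
    (hv : v ∈ W) :
    dsum G W = dsum G (W.erase v) + 2 * (nb G W v).card := by
  unfold dsum
  rw [← Finset.add_sum_erase _ _ hv]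
  have : ∀ a ∈ W.erase v, (nb G W a).card
      = (nb G (W.erase v) a).card + (if a ∈ nb G W v then 1 else 0) := by
    intro a ha
    rw [Finset.mem_erase] at ha
    split_ifs with h
    · rw [mem_nb] at h
      have : nb G W a = insert v (nb G (W.erase v) a) := by
        ext b
        simp only [mem_nb, Finset.mem_insert, Finset.mem_erase]
        constructor
        · rintro ⟨hb, hab⟩
          by_cases hbv : b = v
          · exact Or.inl hbv
          · exact Or.inr ⟨⟨hbv, hb⟩, hab⟩
        · rintro (rfl | ⟨⟨_, hb⟩, hab⟩)
          · exact ⟨hv, h.2.symm⟩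
          · exact ⟨hb, hab⟩
      rw [this, Finset.card_insert_of_notMem]
      simp [mem_nb]
    · congr 1
      ext b
      simp only [mem_nb, Finset.mem_erase]
      constructor
      · rintro ⟨hb, hab⟩
        refine ⟨⟨?_, hb⟩, hab⟩
        rintro rfl
        exact h (mem_nb.2 ⟨ha.2, hab.symm⟩)
      · rintro ⟨⟨_, hb⟩, hab⟩
        exact ⟨hb, hab⟩
  rw [Finset.sum_congr rfl this, Finset.sum_add_distrib, Finset.sum_ite_mem]
  have : (W.erase v) ∩ nb G W v = nb G W v := by
    apply Finset.inter_eq_right.2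
    intro a ha
    rw [mem_nb] at ha
    exact Finset.mem_erase.2 ⟨ha.2.ne', ha.1⟩
  rw [this, Finset.sum_const, smul_eq_mul]
  ring

lemma exists_low {V : Type*} (G : SimpleGraph V) (hG : G.IsAcyclic) (W : Finset V)
    (hW : W.Nonempty) : ∃ v ∈ W, (nb G W v).card ≤ 1 := by
  classical
  have hH : (G.induce (W : Set V)).IsAcyclic := hG.induce _
  have : Nonempty (W : Set V) := by
    obtain ⟨w, hw⟩ := hW
    exact ⟨⟨w, hw⟩⟩
  obtain ⟨u, v, p, hp, hmax⟩ :=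
    SimpleGraph.Walk.exists_isPath_forall_isPath_length_le_length (G.induce (W : Set V))
  refine ⟨v, v.2, ?_⟩
  rw [Finset.card_le_one]
  have key : ∀ a ∈ nb G W v, a = (p.penultimate : V) := by
    intro a ha
    rw [mem_nb] at ha
    have hadj : (G.induce (W : Set V)).Adj v ⟨a, ha.1⟩ := ha.2
    have hs : (⟨a, ha.1⟩ : (W : Set V)) ∈ p.support := by
      by_contra hs
      have := hmax _ _ _ (hp.concat hs hadj)
      simp at this
    have := hH.eq_penultimate_of_adj_end hp hadj hs
    rw [← this]
  intro a ha b hb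
  rw [key a ha, key b hb]

/-- every nonempty vertex set induces a vertex of degree at most one -/
def Low {V : Type*} (G : SimpleGraph V) : Prop :=
  ∀ W : Finset V, W.Nonempty → ∃ v ∈ W, (nb G W v).card ≤ 1

lemma dsum_lt {V : Type*} {G : SimpleGraph V} (hA : Low G) (W : Finset V) (hW : W.Nonempty) :
    dsum G W + 2 ≤ 2 * W.card := by
  classical
  induction hn : W.card using Nat.strong_induction_on generalizing W with
  | _ n ih =>
    obtain ⟨v, hv, hd⟩ := hA W hW
    have h1 := dsum_erase G W v hv
    have h2 := Finset.card_erase_add_one hv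
    by_cases hW' : (W.erase v).Nonempty
    · have := ih _ (by omega) (W.erase v) hW' rfl
      omega
    · rw [Finset.not_nonempty_iff_eq_empty] at hW'
      have h3 : nb G W v = ∅ := by
        apply Finset.eq_empty_of_forall_notMem
        intro a ha
        rw [mem_nb] at ha
        have : a ∈ W.erase v := Finset.mem_erase.2 ⟨ha.2.ne', ha.1⟩
        rw [hW'] at this
        simp at this
      rw [h3, hW'] at h1
      have e0 : dsum G (∅ : Finset V) = 0 := by simp [dsum]
      rw [e0, Finset.card_empty] at h1
      have := Finset.card_pos.2 hW
      omega

lemma dsum_le {V : Type*} {G : SimpleGraph V} (hA : Low G) (W : Finset V) :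
    dsum G W ≤ 2 * W.card := by
  by_cases hW : W.Nonempty
  · have := dsum_lt hA W hW
    omega
  · rw [Finset.not_nonempty_iff_eq_empty] at hW
    simp [hW, dsum]

lemma no_square {V : Type*} {G : SimpleGraph V} (hA : Low G) {a b v p : V} (hvp : v ≠ p)
    (h1 : G.Adj a v) (h2 : G.Adj b v) (h3 : G.Adj a p) (h4 : G.Adj b p) : a = b := by
  classical
  by_contra hab
  obtain ⟨x, hx, hc⟩ := hA {a, b, v, p} (by simp)
  rw [Finset.card_le_one] at hc
  simp only [mem_nb, Finset.mem_insert, Finset.mem_singleton] at hx hc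
  rcases hx with rfl | rfl | rfl | rfl
  · exact hvp (hc v ⟨by simp, h1⟩ p ⟨by simp, h3⟩)
  · exact hvp (hc v ⟨by simp, h2⟩ p ⟨by simp, h4⟩)
  · exact hab (hc a ⟨by simp, h1.symm⟩ b ⟨by simp, h2.symm⟩)
  · exact hab (hc a ⟨by simp, h3.symm⟩ b ⟨by simp, h4.symm⟩)

/-- no isolated vertices, no twin leaves -/
def Valid {V : Type*} (G : SimpleGraph V) (W : Finset V) : Prop :=
  (∀ a ∈ W, nb G W a ≠ ∅) ∧
    ∀ v, ∀ a ∈ W, ∀ b ∈ W, nb G W a = {v} → nb G W b = {v} → a = b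

lemma valid_sub {V : Type*} {G : SimpleGraph V} {W W' : Finset V} (hV : Valid G W)
    (hs : W' ⊆ W)
    (H : ∀ a ∈ W', nb G W' a ≠ nb G W a → nb G W' a ≠ ∅ ∧
      ∀ v, ∀ b ∈ W', nb G W' a = {v} → nb G W' b = {v} → a = b) : Valid G W' := by
  constructor
  · intro a ha
    by_cases h : nb G W' a = nb G W a
    · rw [h]; exact hV.1 a (hs ha)
    · exact (H a ha h).1
  · intro v a ha b hb hav hbv
    by_cases h : nb G W' a = nb G W a
    · by_cases h' : nb G W' b = nb G W b
      · exact hV.2 v a (hs ha) b (hs hb) (h ▸ hav) (h' ▸ hbv)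
      · exact ((H b hb h').2 v a ha hbv hav).symm
    · exact (H a ha h).2 v b hb hav hbv

lemma nb_eq_of {V : Type*} {G : SimpleGraph V} {W W' : Finset V} (hs : W' ⊆ W) (a : V)
    (h : ∀ b ∈ W, G.Adj a b → b ∈ W') : nb G W' a = nb G W a := by
  ext b
  simp only [mem_nb]
  exact ⟨fun ⟨x, y⟩ => ⟨hs x, y⟩, fun ⟨x, y⟩ => ⟨h b x y, y⟩⟩

lemma valid_comp {V : Type*} {G : SimpleGraph V} {W W' : Finset V} (hV : Valid G W)
    (hs : W' ⊆ W) (h : ∀ a ∈ W', ∀ b ∈ W, G.Adj a b → b ∈ W') : Valid G W' :=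
  valid_sub hV hs (fun a ha hne => absurd (nb_eq_of hs a (h a ha)) hne)

lemma valid_one {V : Type*} {G : SimpleGraph V} {W W' : Finset V} (hV : Valid G W)
    (hs : W' ⊆ W) (q : V) (h : ∀ a ∈ W', a ≠ q → ∀ b ∈ W, G.Adj a b → b ∈ W')
    (h1 : nb G W' q ≠ ∅)
    (h2 : ∀ p, ∀ b ∈ W', nb G W' q = {p} → nb G W' b = {p} → q = b) : Valid G W' := by
  refine valid_sub hV hs (fun a ha hne => ?_)
  by_cases haq : a = q
  · subst haq
    exact ⟨h1, h2⟩
  · exact absurd (nb_eq_of hs a (h a ha haq)) hne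

lemma nb_single {V : Type*} {G : SimpleGraph V} {W : Finset V} {a u : V} (h : nb G W a = {u}) :
    u ∈ W ∧ G.Adj a u ∧ ∀ b ∈ W, G.Adj a b → b = u := by
  have hu : u ∈ nb G W a := by rw [h]; simp
  rw [mem_nb] at hu
  refine ⟨hu.1, hu.2, fun b hb hab => ?_⟩
  have : b ∈ nb G W a := mem_nb.2 ⟨hb, hab⟩
  rw [h] at this
  simpa using this

open Classical in
lemma nb_pair {V : Type*} {G : SimpleGraph V} {W : Finset V} {a u v : V}
    (h : nb G W a = {u, v}) :
    u ∈ W ∧ G.Adj a u ∧ v ∈ W ∧ G.Adj a v ∧ ∀ b ∈ W, G.Adj a b → b = u ∨ b = v := by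
  have hu : u ∈ nb G W a := by rw [h]; simp
  have hv : v ∈ nb G W a := by rw [h]; simp
  rw [mem_nb] at hu hv
  refine ⟨hu.1, hu.2, hv.1, hv.2, fun b hb hab => ?_⟩
  have : b ∈ nb G W a := mem_nb.2 ⟨hb, hab⟩
  rw [h] at this
  simpa using this

lemma valid_leaf {V : Type*} {G : SimpleGraph V} {W W' : Finset V} (hV : Valid G W)
    (hs : W' ⊆ W) (q z : V) (h : ∀ a ∈ W', a ≠ q → ∀ b ∈ W, G.Adj a b → b ∈ W')
    (hz : z ∈ W') (hzq : nb G W z = {q}) : Valid G W' := by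
  obtain ⟨hq, hadj, huniq⟩ := nb_single hzq
  have hzn : z ∈ nb G W' q := mem_nb.2 ⟨hz, hadj.symm⟩
  refine valid_one hV hs q h (Finset.ne_empty_of_mem hzn) ?_
  intro p b hb h1 h2
  rw [h1, Finset.mem_singleton] at hzn
  subst hzn
  obtain ⟨_, hbz, _⟩ := nb_single h2
  exact (huniq b (hs hb) hbz.symm).symm

open Classical in
/-- `w` has exactly the neighbours `v`, `p`, and `p` has a leaf. -/
def Bad {V : Type*} (G : SimpleGraph V) (W : Finset V) (v w p : V) : Prop :=
  nb G W w = {v, p} ∧ p ≠ v ∧ ∃ z ∈ W, nb G W z = {p}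

lemma valid_del {V : Type*} {G : SimpleGraph V} (hA : Low G) {W W' : Finset V} (hV : Valid G W)
    (hs : W' ⊆ W) (v : V) (hv : v ∈ W) (hv' : v ∉ W')
    (h : ∀ a ∈ W', ∀ b ∈ W, G.Adj a b → b ∉ W' → b = v)
    (h1 : ∀ a ∈ W', nb G W a ≠ {v}) (h2 : ¬ ∃ w ∈ W, ∃ p, Bad G W v w p) : Valid G W' := by
  classical
  -- affected vertices are the neighbours of `v`
  have aff : ∀ a ∈ W', nb G W' a ≠ nb G W a → nb G W a = insert v (nb G W' a) ∧ G.Adj a v := by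
    intro a ha hne
    have hav : G.Adj a v := by
      by_contra hav
      apply hne
      apply nb_eq_of hs
      intro b hb hab
      by_contra hbW
      exact hav (h a ha b hb hab hbW ▸ hab)
    refine ⟨?_, hav⟩
    ext b
    simp only [mem_nb, Finset.mem_insert]
    constructor
    · rintro ⟨hb, hab⟩
      by_cases hbW : b ∈ W'
      · exact Or.inr ⟨hbW, hab⟩
      · exact Or.inl (h a ha b hb hab hbW)
    · rintro (rfl | ⟨hb, hab⟩)
      · exact ⟨hv, hav⟩
      · exact ⟨hs hb, hab⟩
  refine valid_sub hV hs (fun a ha hne => ?_)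
  obtain ⟨hnb, hav⟩ := aff a ha hne
  constructor
  · intro h0
    rw [h0] at hnb
    exact h1 a ha (by simpa using hnb)
  · intro p b hb hap hbp
    obtain ⟨hp, hap', _⟩ := nb_single hap
    obtain ⟨_, hbp', _⟩ := nb_single hbp
    have hpv : p ≠ v := by rintro rfl; exact hv' hp
    by_cases hb' : nb G W' b = nb G W b
    · exfalso
      exact h2 ⟨a, hs ha, p, by rw [hnb, hap], hpv, b, hs hb, by rw [← hb', hbp]⟩
    · obtain ⟨_, hbv⟩ := aff b hb hb'
      exact no_square hA hpv.symm hav hbv hap' hbp'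

lemma exists_leaf {V : Type*} {G : SimpleGraph V} (hA : Low G) {W : Finset V} (hV : Valid G W)
    (hW : W.Nonempty) : ∃ l ∈ W, ∃ u ∈ W, nb G W l = {u} ∧ (nb G W u).card ≤ 2 := by
  classical
  by_cases h0 : ∀ v ∈ W, (nb G W v).card ≤ 1
  · obtain ⟨l, hl⟩ := hW
    have h1 : (nb G W l).card = 1 := by
      have := h0 l hl
      have := Finset.card_pos.2 (Finset.nonempty_iff_ne_empty.2 (hV.1 l hl))
      omega
    obtain ⟨u, hu⟩ := Finset.card_eq_one.1 h1
    have hu' := (nb_single hu).1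
    exact ⟨l, hl, u, hu', hu, (h0 u hu').trans (by omega)⟩
  · push Not at h0
    obtain ⟨v0, hv0, hv0'⟩ := h0
    obtain ⟨u, hu, hc⟩ := hA (W.filter (fun v => 1 < (nb G W v).card))
      ⟨v0, by simp [hv0, hv0']⟩
    rw [Finset.mem_filter] at hu
    -- the leaves next to `u`
    have hsplit : (nb G W u) = nb G (W.filter (fun v => 1 < (nb G W v).card)) u ∪
        (nb G W u).filter (fun v => ¬ 1 < (nb G W v).card) := by
      ext b
      simp only [mem_nb, Finset.mem_union, Finset.mem_filter]
      tauto
    have hleaf : ∀ a ∈ (nb G W u).filter (fun v => ¬ 1 < (nb G W v).card),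
        a ∈ W ∧ nb G W a = {u} := by
      intro a ha
      rw [Finset.mem_filter, mem_nb] at ha
      refine ⟨ha.1.1, ?_⟩
      have h1 : u ∈ nb G W a := mem_nb.2 ⟨hu.1, ha.1.2.symm⟩
      have h2 := Finset.card_pos.2 ⟨u, h1⟩
      obtain ⟨x, hx⟩ := Finset.card_eq_one.1 (show (nb G W a).card = 1 by omega)
      rw [hx, Finset.mem_singleton] at h1
      rw [hx, h1]
    have hle : ((nb G W u).filter (fun v => ¬ 1 < (nb G W v).card)).card ≤ 1 := by
      rw [Finset.card_le_one]
      intro a ha b hb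
      obtain ⟨ha1, ha2⟩ := hleaf a ha
      obtain ⟨hb1, hb2⟩ := hleaf b hb
      exact hV.2 u a ha1 b hb1 ha2 hb2
    have hcu := congrArg Finset.card hsplit
    have hun := Finset.card_union_le (nb G (W.filter (fun v => 1 < (nb G W v).card)) u)
      ((nb G W u).filter (fun v => ¬ 1 < (nb G W v).card))
    have : 0 < ((nb G W u).filter (fun v => ¬ 1 < (nb G W v).card)).card := by omega
    obtain ⟨l, hl⟩ := Finset.card_pos.1 this
    obtain ⟨hl1, hl2⟩ := hleaf l hl
    exact ⟨l, hl1, u, hu.1, hl2, by omega⟩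

lemma nb_erase {V : Type*} [DecidableEq V] (G : SimpleGraph V) (W : Finset V) (x a : V) :
    nb G (W.erase x) a = (nb G W a).erase x := by
  ext b
  simp only [mem_nb, Finset.mem_erase]
  tauto

theorem main_bound {V : Type*} {G : SimpleGraph V} (hA : Low G) (W : Finset V) (hV : Valid G W)
    (N : ℕ) (hN : 2 * N + dsum G W ≤ 4 * W.card) : hh N ≤ cnt G W := by
  classical
  induction hn : W.card using Nat.strong_induction_on generalizing W N with
  | _ n ih =>
  subst hn
  by_cases hW : W.Nonempty
  swap
  · rw [Finset.not_nonempty_iff_eq_empty] at hW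
    subst hW
    simp at hN
    obtain ⟨rfl, -⟩ := hN
    exact cnt_empty G
  obtain ⟨l, hl, u, hu, hnl, hcu⟩ := exists_leaf hA hV hW
  obtain ⟨-, hlu, hl1⟩ := nb_single hnl
  have hlu' : l ≠ u := hlu.ne
  have huW1 : u ∈ W.erase l := Finset.mem_erase.2 ⟨hlu'.symm, hu⟩
  have hlnb : l ∈ nb G W u := mem_nb.2 ⟨hl, hlu.symm⟩
  have c1 := Finset.card_erase_add_one hl
  have c2 := Finset.card_erase_add_one huW1
  have d1 := dsum_erase G W l hl
  have d2 := dsum_erase G (W.erase l) u huW1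
  rw [hnl, Finset.card_singleton] at d1
  rw [nb_erase, Finset.card_erase_of_mem hlnb] at d2
  have s1 : (W.erase l).erase u ⊆ W :=
    (Finset.erase_subset _ _).trans (Finset.erase_subset _ _)
  have t1 := dsum_le hA ((W.erase l).erase u)
  have nl1 : ∀ a ∈ (W.erase l).erase u, ¬ G.Adj l a := by
    intro a ha hadj
    simp only [Finset.mem_erase] at ha
    exact ha.1 (hl1 a ha.2.2 hadj)
  have hcpos := Finset.card_pos.2 ⟨l, hlnb⟩
  by_cases hu1 : (nb G W u).card = 1
  · -- component with two vertices
    obtain ⟨x, hx⟩ := Finset.card_eq_one.1 hu1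
    have hxl : x = l := by rw [hx, Finset.mem_singleton] at hlnb; exact hlnb.symm
    subst hxl
    obtain ⟨-, -, hu2⟩ := nb_single hx
    have v1 : Valid G ((W.erase x).erase u) := by
      apply valid_comp hV s1
      intro a ha b hb hab
      simp only [Finset.mem_erase] at ha ⊢
      grind [SimpleGraph.Adj.symm]
    have := ih _ (by omega) _ v1 (N - 3) (by omega) rfl
    have h2 := cnt_add G W _ _ s1 s1 x u hl hu hlu nl1 (by
      intro a ha hadj
      simp only [Finset.mem_erase] at ha
      exact ha.2.1 (hu2 a ha.2.2 hadj))
    have := hh_three N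
    omega
  have hu2 : (nb G W u).card = 2 := by omega
  obtain ⟨v, hvl, hnu⟩ : ∃ v, v ≠ l ∧ nb G W u = {l, v} := by
    obtain ⟨x, y, hxy, hx⟩ := Finset.card_eq_two.1 hu2
    rw [hx] at hlnb
    simp only [Finset.mem_insert, Finset.mem_singleton] at hlnb
    rcases hlnb with rfl | rfl
    · exact ⟨y, hxy.symm, hx⟩
    · exact ⟨x, hxy, by rw [hx, Finset.pair_comm]⟩
  obtain ⟨-, -, hv, huv, hu3⟩ := nb_pair hnu
  have hunv : u ∈ nb G W v := mem_nb.2 ⟨hu, huv.symm⟩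
  have huv' : u ≠ v := huv.ne
  have hnlv : ¬ G.Adj l v := fun h => huv' (hl1 v hv h).symm
  rw [hu2] at d2
  have hvW : v ∈ (W.erase l).erase u := by simp [hv, hvl, huv'.symm]
  have c3 := Finset.card_erase_add_one hvW
  have d3 := dsum_erase G _ v hvW
  have hlnv : l ∉ nb G W v := fun h => hnlv (mem_nb.1 h).2.symm
  rw [nb_erase, nb_erase, Finset.erase_eq_of_notMem hlnv, Finset.card_erase_of_mem hunv] at d3
  have d0 := dsum_erase G W v hv
  have c0 := Finset.card_erase_add_one hv
  have hvc : 2 ≤ (nb G W v).card := by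
    by_contra hcon
    have := Finset.card_pos.2 ⟨u, hunv⟩
    obtain ⟨x, hx⟩ := Finset.card_eq_one.1 (show (nb G W v).card = 1 by omega)
    have : u = x := by rw [hx] at hunv; simpa using hunv
    subst this
    exact hvl (hV.2 u v hv l hl hx hnl)
  by_cases hb : ∃ w ∈ W, ∃ p, Bad G W v w p
  · obtain ⟨w, hw, p, hnw, hpv, z, hz, hnz⟩ := hb
    obtain ⟨-, hwv, hp, hwp, hw3⟩ := nb_pair hnw
    obtain ⟨-, hzp, hz1⟩ := nb_single hnz
    have hwu : w ≠ u := by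
      rintro rfl
      have h1 : p = l := by grind
      subst h1
      have h2 : z = w := hl1 z hz hzp.symm
      subst h2
      exact hpv (hz1 v hv huv).symm
    have hzw : z ≠ w := by
      rintro rfl
      exact hpv (hz1 v hv hwv).symm
    by_cases hD : 3 ≤ (nb G W v).card ∨ ∃ y ∈ W, nb G W y = {v}
    · -- delete `w`
      have hw2 : (nb G W w).card = 2 := by
        rw [hnw, Finset.card_pair hpv.symm]
      have dw := dsum_erase G W w hw
      have cw := Finset.card_erase_add_one hw
      have vw : Valid G (W.erase w) := by
        refine valid_del hA hV (Finset.erase_subset _ _) w hw (by simp) ?_ ?_ ?_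
        · intro a _ b hb _ hbW
          by_contra hbw
          exact hbW (Finset.mem_erase.2 ⟨hbw, hb⟩)
        · intro a ha hna
          rw [Finset.mem_erase] at ha
          obtain ⟨-, haw, ha1⟩ := nb_single hna
          rcases hw3 a ha.2 haw.symm with rfl | rfl
          · exact hwu (ha1 u hu huv.symm).symm
          · exact hzw (ha1 z hz hzp.symm)
        · rintro ⟨a, ha, q, hna, hqw, zb, hzb, hnzb⟩
          obtain ⟨-, haw, hq, haq, ha3⟩ := nb_pair hna
          obtain ⟨-, hzbq, hzb1⟩ := nb_single hnzb
          rcases hw3 a ha haw.symm with rfl | rfl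
          · rcases hD with hD | ⟨y, hy, hny⟩
            · rw [hna, Finset.card_pair hqw.symm] at hD
              omega
            · obtain ⟨-, hya, hy1⟩ := nb_single hny
              rcases ha3 y hy hya.symm with rfl | rfl
              · exact hpv (hy1 p hp hwp)
              · rcases ha3 u hu huv.symm with h | h
                · exact hwu h.symm
                · subst h
                  exact hvl (hy1 l hl hlu.symm).symm
          · rcases ha3 z hz hzp.symm with h | h
            · exact hzw h
            · subst h
              have : zb = a := hz1 zb hzb hzbq.symm
              subst this
              exact hzw (hzb1 w hw haw).symm
      have := ih _ (by omega) _ vw N (by omega) rfl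
      exact this.trans (cnt_mono G _ _ (Finset.erase_subset _ _))
    · push Not at hD
      have hv2 : (nb G W v).card = 2 := by omega
      have hwnv : w ∈ nb G W v := mem_nb.2 ⟨hw, hwv.symm⟩
      have hnv : nb G W v = {u, w} := by
        symm
        apply Finset.eq_of_subset_of_card_le
        · intro a ha
          simp only [Finset.mem_insert, Finset.mem_singleton] at ha
          rcases ha with rfl | rfl
          · exact hunv
          · exact hwnv
        · rw [Finset.card_pair hwu.symm, hv2]
      obtain ⟨-, -, -, -, hv3⟩ := nb_pair hnv
      have hwl : w ≠ l := by rintro rfl; exact hlnv hwnv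
      have hpl : p ≠ l := by
        rintro rfl
        exact hwu (hl1 w hw hwp.symm)
      have hpu : p ≠ u := by
        rintro rfl
        rcases hu3 w hw hwp.symm with h | h
        · exact hwl h
        · exact hwv.ne h
      have hzl : z ≠ l := by
        rintro rfl
        exact hpu (hl1 p hp hzp)
      have hzu : z ≠ u := by
        rintro rfl
        exact hpv (hz1 v hv huv).symm
      have hzv : z ≠ v := by
        rintro rfl
        exact hpu (hz1 u hu huv.symm).symm
      have v1 : Valid G ((W.erase l).erase u) := by
        have e : nb G ((W.erase l).erase u) v = {w} := by
          rw [nb_erase, nb_erase, Finset.erase_eq_of_notMem hlnv, hnv]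
          rw [Finset.erase_insert]
          simpa using hwu.symm
        refine valid_one hV s1 v ?_ ?_ ?_
        · intro a ha hav b hb hab
          simp only [Finset.mem_erase] at ha ⊢
          grind [SimpleGraph.Adj.symm]
        · rw [e]; simp
        · intro q b hb h1 h2
          rw [e, Finset.singleton_inj] at h1
          subst h1
          obtain ⟨-, hbw, hb1⟩ := nb_single h2
          rcases hw3 b (s1 hb) hbw.symm with h | h
          · exact h.symm
          · subst h
            exact absurd (hb1 z (by simp [hz, hzl, hzu]) hzp.symm) hzw
      have hwW : w ∈ ((W.erase l).erase u).erase v := by simp [hw, hwl, hwu, hwv.ne]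
      have c4 := Finset.card_erase_add_one hwW
      have d4 := dsum_erase G _ w hwW
      have hpn : p ∈ nb G (((W.erase l).erase u).erase v) w :=
        mem_nb.2 ⟨by simp [hp, hpl, hpu, hpv], hwp⟩
      have hpc := Finset.card_pos.2 ⟨p, hpn⟩
      have s2 : (((W.erase l).erase u).erase v).erase w ⊆ W :=
        (Finset.erase_subset _ _).trans ((Finset.erase_subset _ _).trans s1)
      have t2 := dsum_le hA ((((W.erase l).erase u).erase v).erase w)
      have v2 : Valid G ((((W.erase l).erase u).erase v).erase w) := by
        refine valid_leaf hV s2 p z ?_ (by simp [hz, hzl, hzu, hzv, hzw]) hnz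
        intro a ha hap b hb hab
        simp only [Finset.mem_erase] at ha ⊢
        grind [SimpleGraph.Adj.symm]
      have i1 := ih _ (by omega) _ v1 (N - 2) (by omega) rfl
      have i2 := ih _ (by omega) _ v2 (N - 4) (by omega) rfl
      have h2 := cnt_add G W _ _ s1 s2 l u hl hu hlu nl1 (by
        intro a ha hadj
        simp only [Finset.mem_erase] at ha
        grind)
      have := hh_two_four N
      omega
  by_cases hy : ∃ y ∈ W, nb G W y = {v}
  · obtain ⟨y, hyW, hny⟩ := hy
    obtain ⟨-, hyv, hy1⟩ := nb_single hny
    have hyl : y ≠ l := by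
      rintro rfl
      exact hnlv hyv
    have hyu : y ≠ u := by
      rintro rfl
      exact hvl (hy1 l hl hlu.symm).symm
    have hynv : y ∈ nb G W v := mem_nb.2 ⟨hyW, hyv.symm⟩
    have v1 : Valid G ((W.erase l).erase u) := by
      refine valid_leaf hV s1 v y ?_ (by simp [hyW, hyl, hyu]) hny
      intro a ha hav b hb hab
      simp only [Finset.mem_erase] at ha ⊢
      grind [SimpleGraph.Adj.symm]
    have hyW3 : y ∈ ((W.erase l).erase u).erase v := by simp [hyW, hyl, hyu, hyv.ne]
    have c4 := Finset.card_erase_add_one hyW3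
    have d4 := dsum_erase G _ y hyW3
    have s21 : (((W.erase l).erase u).erase v).erase y ⊆ (W.erase l).erase u :=
      (Finset.erase_subset _ _).trans (Finset.erase_subset _ _)
    have s2 : (((W.erase l).erase u).erase v).erase y ⊆ W := s21.trans s1
    have t2 := dsum_le hA ((((W.erase l).erase u).erase v).erase y)
    have nu2 : ∀ a ∈ (((W.erase l).erase u).erase v).erase y, ¬ G.Adj u a := by
      intro a ha hadj
      simp only [Finset.mem_erase] at ha
      grind
    have h2 := cnt_add G W _ _ s1 s2 l u hl hu hlu nl1 nu2
    by_cases hv2 : (nb G W v).card = 2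
    · have hnv : nb G W v = {u, y} := by
        symm
        apply Finset.eq_of_subset_of_card_le
        · intro a ha
          simp only [Finset.mem_insert, Finset.mem_singleton] at ha
          rcases ha with rfl | rfl
          · exact hunv
          · exact hynv
        · rw [Finset.card_pair hyu.symm, hv2]
      obtain ⟨-, -, -, -, hv3⟩ := nb_pair hnv
      have v2 : Valid G ((((W.erase l).erase u).erase v).erase y) := by
        apply valid_comp hV s2
        intro a ha b hb hab
        simp only [Finset.mem_erase] at ha ⊢
        grind [SimpleGraph.Adj.symm]
      have i2 := ih _ (by omega) _ v2 (N - 5) (by omega) rfl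
      have h3 := cnt_add G ((W.erase l).erase u) _ _ s21 s21 y v
        (by simp [hyW, hyl, hyu]) hvW hyv
        (by
          intro a ha hadj
          simp only [Finset.mem_erase] at ha
          grind)
        (by
          intro a ha hadj
          simp only [Finset.mem_erase] at ha
          grind)
      have := hh_five N
      omega
    · have v2 : Valid G ((((W.erase l).erase u).erase v).erase y) := by
        refine valid_del hA hV s2 v hv (by simp) ?_ ?_ hb
        · intro a ha b hb hab hbW
          simp only [Finset.mem_erase] at ha hbW
          grind [SimpleGraph.Adj.symm]
        · intro a ha hna
          have := hV.2 v a (s2 ha) y hyW hna hny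
          subst this
          simp at ha
      have i1 := ih _ (by omega) _ v1 (N - 2) (by omega) rfl
      have i2 := ih _ (by omega) _ v2 (N - 4) (by omega) rfl
      have := hh_two_four N
      omega
  · -- delete `v`
    have v0 : Valid G (W.erase v) := by
      refine valid_del hA hV (Finset.erase_subset _ _) v hv (by simp) ?_ ?_ hb
      · intro a _ b hb _ hbW
        by_contra hbw
        exact hbW (Finset.mem_erase.2 ⟨hbw, hb⟩)
      · intro a ha hna
        exact hy ⟨a, (Finset.mem_erase.1 ha).2, hna⟩
    have := ih _ (by omega) _ v0 N (by omega) rfl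
    exact this.trans (cnt_mono G _ _ (Finset.erase_subset _ _))

end Helpers

theorem stmt_15 {V : Type*} [Fintype V] (F : SimpleGraph V)
    (hforest : F.IsAcyclic) (htf : TwinFree F) (hn : 2 ≤ Fintype.card V) :
    f (Fintype.card V - 1) ≤ (imax F : ℝ) := by
  classical
  have hA : Low F := fun W hW => exists_low F hforest W hW
  have tf : ∀ a b : V, nb F Finset.univ a = nb F Finset.univ b → a = b := by
    intro a b h
    apply htf
    ext c
    have : c ∈ nb F Finset.univ a ↔ c ∈ nb F Finset.univ b := by rw [h]
    simpa [mem_nb] using this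
  have key : ∃ W : Finset V, Valid F W ∧ Fintype.card V - 1 ≤ W.card := by
    by_cases hiso : ∃ i, nb F Finset.univ i = ∅
    · obtain ⟨i, hi⟩ := hiso
      have hnadj : ∀ a, ¬ F.Adj a i := by
        intro a ha
        have : a ∈ nb F Finset.univ i := mem_nb.2 ⟨Finset.mem_univ _, ha.symm⟩
        rw [hi] at this
        simp at this
      have e : ∀ a, nb F (Finset.univ.erase i) a = nb F Finset.univ a := by
        intro a
        rw [nb_erase, Finset.erase_eq_of_notMem]
        intro h
        exact hnadj a (mem_nb.1 h).2
      refine ⟨Finset.univ.erase i, ⟨?_, ?_⟩, ?_⟩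
      · intro a ha h0
        rw [e] at h0
        exact (Finset.mem_erase.1 ha).1 (tf a i (h0.trans hi.symm))
      · intro v a _ b _ h1 h2
        rw [e] at h1 h2
        exact tf a b (h1.trans h2.symm)
      · rw [Finset.card_erase_of_mem (Finset.mem_univ _), Finset.card_univ]
    · push Not at hiso
      refine ⟨Finset.univ, ⟨fun a _ => ?_, ?_⟩, ?_⟩
      · exact (hiso a).ne_empty
      · intro v a _ b _ h1 h2
        exact tf a b (h1.trans h2.symm)
      · rw [Finset.card_univ]; omega
  obtain ⟨W, hV, hc⟩ := key
  have hd := dsum_lt hA W (Finset.card_pos.1 (by omega))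
  have h1 := main_bound hA W hV (Fintype.card V) (by omega)
  have h2 := cnt_mono F Finset.univ W (Finset.subset_univ _)
  have h3 := cnt_le_imax F
  have h4 := f_le_hh (Fintype.card V - 1)
  rw [show Fintype.card V - 1 + 1 = Fintype.card V by omega] at h4
  refine h4.trans ?_
  exact_mod_cast h1.trans (h2.trans h3)
end
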